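/- Let S¹ = {p ∈ ℝ² : |p| = 1} be the unit circle with the Euclidean metric, and let 0 < r < 2. Then TC_r(S¹) = 2: there exist two open subsets U₁, U₂ of S¹ × S¹ with U₁ ∪ U₂ = S¹ × S¹ such that each Uᵢ admits an r-motion planning, and there is no r-motion planning defined on all of S¹ × S¹. -/

import Mathlib

/-- `s` is an `r`-motion planning on `A ⊆ X × X` with paths of length `m`. -/
def MotionPlan {X : Type*} [MetricSpace X] (r : ℝ) (A : Set (X × X)) (m : ℕ)
    (s : X × X → ℕ → X) : Prop :=
  (∀ p ∈ A, s p 0 = p.1 ∧ s p m = p.2 ∧ ∀ i < m, dist (s p i) (s p (i + 1)) ≤ r) ∧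
  (∀ p ∈ A, ∀ q ∈ A, ∀ i ≤ m, dist (s p i) (s q i) ≤ dist p.1 q.1 + dist p.2 q.2)

/-- `A` admits an `r`-motion planning. -/
def HasMotionPlan {X : Type*} [MetricSpace X] (r : ℝ) (A : Set (X × X)) : Prop :=
  ∃ (m : ℕ) (s : X × X → ℕ → X), MotionPlan r A m s

/-- `X × X` is covered by `l` open subsets each admitting an `r`-motion planning. -/
def CoverMP (X : Type*) [MetricSpace X] (r : ℝ) (l : ℕ) : Prop :=
  ∃ U : Fin l → Set (X × X), (∀ i, IsOpen (U i)) ∧ (⋃ i, U i) = Set.univ ∧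
    ∀ i, HasMotionPlan r (U i)

/-- The discrete topological complexity `TC_r(X)`. -/
noncomputable def dTC (r : ℝ) (X : Type*) [MetricSpace X] : ℕ∞ :=
  sInf {n : ℕ∞ | ∃ l : ℕ, n = l ∧ CoverMP X r l}

/-- The unit circle in `ℝ²`. -/
def Circle2 : Set (EuclideanSpace ℝ (Fin 2)) := Metric.sphere 0 1

open Real in
/-- The key trigonometric estimate: a point `w` between `u` and `v`, away from the ends when `v - u`
exceeds a quarter turn, satisfies `sin w ≤ |sin u| + |sin v|`. -/
lemma sin_le_abs_sin_add_abs_sin {δ η u v w : ℝ} (hδ : 0 < δ) (hη : δ * 3 ≤ η) (hη1 : η ≤ 1 / 2)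
    (hw0 : 0 ≤ w) (hw1 : w ≤ π / 2) (huw : u ≤ w) (hwv : w ≤ v) (hu : w - u ≤ π / 2 - η)
    (hv : v - w ≤ π / 2 - η) (huv : v - u ≤ π / 2 + δ) :
    sin w ≤ |sin u| + |sin v| := by
  have hπ := pi_gt_three
  by_cases hvw : v ≤ π - w
  · have : sin w ≤ sin v := by
      by_cases hv2 : v ≤ π / 2
      · exact sin_le_sin_of_le_of_le_pi_div_two (by linarith) hv2 hwv
      · rw [← sin_pi_sub v]
        exact sin_le_sin_of_le_of_le_pi_div_two (by linarith) (by linarith) (by linarith)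
    linarith [le_abs_self (sin v), abs_nonneg (sin u)]
  have hu0 : 0 < u := by by_contra! h; linarith
  obtain ⟨t, rfl⟩ : ∃ t, v = π - t := ⟨π - v, by ring⟩
  rw [sin_pi_sub]
  have key : sin w ≤ sin u + sin t := by
    by_cases hut : w ≤ u + t
    · have h1 : sin (w - u) ≤ sin t :=
        sin_le_sin_of_le_of_le_pi_div_two (by linarith) (by linarith) (by linarith)
      have h2 : sin w = sin u * cos (w - u) + cos u * sin (w - u) := by
        rw [← sin_add]; ring_nf
      have h3 : 0 ≤ sin u := sin_nonneg_of_nonneg_of_le_pi (by linarith) (by linarith)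
      have h4 : 0 ≤ sin (w - u) := sin_nonneg_of_nonneg_of_le_pi (by linarith) (by linarith)
      nlinarith [cos_le_one u, cos_le_one (w - u)]
    · have ht0 : η ≤ t := by linarith
      have ht1 : t ≤ π / 2 - η := by linarith
      have h1 : cos (t + δ) ≤ sin u := by
        rw [← sin_pi_div_two_sub]
        exact sin_le_sin_of_le_of_le_pi_div_two (by linarith) (by linarith) (by linarith)
      have hst : 0 ≤ sin t := sin_nonneg_of_nonneg_of_le_pi (by linarith) (by linarith)
      have hct : 0 ≤ cos t := cos_nonneg_of_mem_Icc ⟨by linarith, by linarith⟩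
      have h2 : cos t - δ ≤ cos (t + δ) := by
        have := abs_cos_sub_cos_le t (t + δ)
        rw [show t - (t + δ) = -δ by ring, abs_neg, abs_of_pos hδ] at this
        linarith [le_abs_self (cos t - cos (t + δ))]
      have h3 : η ≤ sin (2 * t) := by
        have h5 : sin (2 * η) ≤ sin (2 * t) := by
          by_cases h : t ≤ π / 4
          · exact sin_le_sin_of_le_of_le_pi_div_two (by linarith) (by linarith) (by linarith)
          · rw [← sin_pi_sub (2 * t)]
            exact sin_le_sin_of_le_of_le_pi_div_two (by linarith) (by linarith) (by linarith)
        have h6 := mul_le_sin (x := 2 * η) (by linarith) (by linarith)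
        have h7 : η ≤ 2 / π * (2 * η) := by
          rw [div_mul_eq_mul_div, le_div_iff₀ pi_pos]
          nlinarith [pi_le_four]
        linarith
      have h4 : 1 + δ ≤ sin t + cos t := by
        rw [sin_two_mul] at h3
        have := sin_sq_add_cos_sq t
        exact le_of_abs_le (abs_le_of_sq_le_sq (by nlinarith) (by linarith))
      linarith [sin_le_one w]
  linarith [le_abs_self (sin u), le_abs_self (sin t)]

open Real in
lemma abs_sin_le_abs_sin_add_abs_sin {δ η u v w : ℝ} (hδ : 0 < δ) (hη : δ * 3 ≤ η)
    (hη1 : η ≤ 1 / 2) (hw : w ∈ Set.uIcc u v) (hu : |w - u| ≤ π / 2 - η)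
    (hv : |v - w| ≤ π / 2 - η) (huv : |v - u| ≤ π / 2 + δ) :
    |sin w| ≤ |sin u| + |sin v| := by
  wlog hle : u ≤ v generalizing u v
  · rw [add_comm]
    exact this (Set.uIcc_comm u v ▸ hw) (abs_sub_comm w v ▸ hv) (abs_sub_comm w u ▸ hu)
      (abs_sub_comm v u ▸ huv) (le_of_not_ge hle)
  rw [Set.uIcc_of_le hle] at hw
  obtain ⟨h1, h2⟩ := hw
  rw [abs_of_nonneg (by linarith)] at hu hv huv
  -- reduce modulo `π`
  obtain ⟨k, hk⟩ : ∃ k : ℤ, |w - k * π| ≤ π / 2 := by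
    refine ⟨round (w / π), ?_⟩
    have := abs_sub_round (w / π)
    have h3 : w - round (w / π) * π = (w / π - round (w / π)) * π := by
      field_simp
    rw [h3, abs_mul, abs_of_pos pi_pos]
    nlinarith [pi_pos]
  have hs : ∀ x, |sin (x - k * π)| = |sin x| := fun x => by
    rw [sin_sub_int_mul_pi, abs_mul, abs_zpow]; simp
  rw [← hs w, ← hs u, ← hs v]
  obtain ⟨h3, h4⟩ := abs_le.1 hk
  rcases le_total 0 (w - k * π) with h0 | h0
  · rw [abs_of_nonneg (sin_nonneg_of_nonneg_of_le_pi h0 (by linarith [pi_pos]))]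
    exact sin_le_abs_sin_add_abs_sin hδ hη hη1 h0 h4 (by linarith) (by linarith) (by linarith)
      (by linarith) (by linarith)
  · rw [← abs_neg, ← abs_neg (sin (u - _)), ← abs_neg (sin (v - _)), ← sin_neg, ← sin_neg, ← sin_neg,
      abs_of_nonneg (sin_nonneg_of_nonneg_of_le_pi (by linarith) (by linarith [pi_pos])), add_comm]
    exact sin_le_abs_sin_add_abs_sin hδ hη hη1 (by linarith) (by linarith) (by linarith)
      (by linarith) (by linarith) (by linarith) (by linarith)

namespace Circle2

open Real

/-- The point of the circle at angle `t`. -/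
noncomputable def ofAngle (t : ℝ) : ↥Circle2 :=
  ⟨!₂[cos t, sin t], by simp [Circle2, EuclideanSpace.norm_eq]⟩

@[simp] lemma ofAngle_zero_coord (t : ℝ) : (ofAngle t).1 0 = cos t := rfl

@[simp] lemma ofAngle_one_coord (t : ℝ) : (ofAngle t).1 1 = sin t := rfl

lemma sq_add_sq (x : ↥Circle2) : x.1 0 ^ 2 + x.1 1 ^ 2 = 1 := by
  have h : ‖x.1‖ = 1 := by simpa [Circle2] using x.2
  have := EuclideanSpace.norm_sq_eq x.1
  rw [h] at this
  simpa using this.symm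

lemma ext_coord {x y : ↥Circle2} (h0 : x.1 0 = y.1 0) (h1 : x.1 1 = y.1 1) : x = y := by
  apply Subtype.ext
  ext i
  fin_cases i
  · exact h0
  · exact h1

lemma exists_ofAngle (x : ↥Circle2) : ∃ t, ofAngle t = x := by
  have hx : ‖(⟨x.1 0, x.1 1⟩ : ℂ)‖ = 1 := by
    rw [Complex.norm_def, Complex.normSq_mk, ← sq, ← sq, sq_add_sq, sqrt_one]
  have h0 : (⟨x.1 0, x.1 1⟩ : ℂ) ≠ 0 := by intro h; simp [h] at hx
  refine ⟨Complex.arg ⟨x.1 0, x.1 1⟩, ext_coord ?_ ?_⟩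
  · simp [Complex.cos_arg h0, hx]
  · simp [Complex.sin_arg, hx]

lemma dist_ofAngle (a b : ℝ) : dist (ofAngle a) (ofAngle b) = 2 * |sin ((a - b) / 2)| := by
  rw [Subtype.dist_eq, EuclideanSpace.dist_eq, Fin.sum_univ_two, Real.dist_eq, Real.dist_eq,
    sq_abs, sq_abs]
  simp only [ofAngle_zero_coord, ofAngle_one_coord]
  rw [sqrt_eq_iff_mul_self_eq (by positivity) (by positivity), cos_sub_cos, sin_sub_sin]
  have := sin_sq_add_cos_sq ((a + b) / 2)
  rw [mul_mul_mul_comm, abs_mul_abs_self]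
  linear_combination (4 * sin ((a - b) / 2) ^ 2) * this

lemma dist_ofAngle_le (a b : ℝ) : dist (ofAngle a) (ofAngle b) ≤ |a - b| := by
  rw [dist_ofAngle]
  have := abs_sin_le_abs (x := (a - b) / 2)
  rw [abs_div, abs_two] at this
  linarith

lemma ofAngle_add_int_mul (a : ℝ) (k : ℤ) : ofAngle (a + k * (2 * π)) = ofAngle a :=
  ext_coord (by simp) (by simp)

/-- The inner product of two points of the circle. -/
noncomputable def dot (x y : ↥Circle2) : ℝ := x.1 0 * y.1 0 + x.1 1 * y.1 1

lemma dot_ofAngle (a b : ℝ) : dot (ofAngle a) (ofAngle b) = cos (b - a) := by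
  simp [dot, cos_sub]; ring

lemma continuous_dot : Continuous fun p : ↥Circle2 × ↥Circle2 => dot p.1 p.2 := by
  unfold dot; fun_prop

lemma exists_angles {c M : ℝ} (hM0 : 0 ≤ M) (hM : M ≤ π) (hc : sin c = 0) {p : ↥Circle2 × ↥Circle2}
    (hp : cos M < cos c * dot p.1 p.2) :
    ∃ q : ℝ × ℝ, ofAngle q.1 = p.1 ∧ ofAngle q.2 = p.2 ∧ |q.2 - q.1 - c| ≤ M := by
  obtain ⟨x, y⟩ := p
  obtain ⟨a, rfl⟩ := exists_ofAngle x
  obtain ⟨b, rfl⟩ := exists_ofAngle y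
  set k : ℤ := round ((b - a - c) / (2 * π))
  have hk : |b - a - c - k * (2 * π)| ≤ π := by
    have := abs_sub_round ((b - a - c) / (2 * π))
    have h3 : b - a - c - k * (2 * π) = ((b - a - c) / (2 * π) - k) * (2 * π) := by
      field_simp
    rw [h3, abs_mul, abs_of_pos two_pi_pos]
    nlinarith [pi_pos]
  refine ⟨(a, b + (-k : ℤ) * (2 * π)), rfl, ofAngle_add_int_mul _ _, ?_⟩
  have hcos : cos M < cos |b - a - c - k * (2 * π)| := by
    rw [cos_abs, cos_sub_int_mul_two_pi, cos_sub, hc, ← dot_ofAngle]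
    linarith
  have : b + (-k : ℤ) * (2 * π) - a - c = b - a - c - k * (2 * π) := by push_cast; ring
  simp only [this]
  by_contra! h
  exact (cos_le_cos_of_nonneg_of_le_pi hM0 hk h.le).not_gt hcos

lemma hasMotionPlan_band {r c : ℝ} {m : ℕ} (hm : 2 ≤ m) (hr : 7 ≤ r * m) (hc : sin c = 0)
    (hcπ : |c| ≤ π) :
    HasMotionPlan r {p : ↥Circle2 × ↥Circle2 |
      cos (π / 2 + 1 / (3 * m)) < cos c * dot p.1 p.2} := by
  set M : ℝ := π / 2 + 1 / (3 * m)
  have hm' : (2 : ℝ) ≤ m := by exact_mod_cast hm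
  have hm0 : (0 : ℝ) < m := by linarith
  have hδ : 0 < 1 / (3 * (m : ℝ)) := by positivity
  have hη : 1 / (3 * (m : ℝ)) * 3 = 1 / m := by field_simp
  have hη1 : 1 / (m : ℝ) ≤ 1 / 2 := one_div_le_one_div_of_le (by norm_num) hm'
  have hπ := pi_gt_d2
  have hπ' := pi_lt_d2
  have hM0 : 0 ≤ M := by simp only [M]; linarith
  have hMπ : M ≤ π := by simp only [M]; linarith
  choose! q hq1 hq2 hq using
    fun (p : ↥Circle2 × ↥Circle2) (hp : cos M < cos c * dot p.1 p.2) =>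
      exists_angles hM0 hMπ hc hp
  refine ⟨m, fun p i => ofAngle ((q p).1 + (i / m : ℝ) * ((q p).2 - (q p).1)), ?_, ?_⟩
  · intro p hp
    refine ⟨by simp [hq1 p hp], by simp [hm0.ne', hq2 p hp], fun i _ => ?_⟩
    refine (dist_ofAngle_le _ _).trans ?_
    have h1 : (q p).1 + (i / m : ℝ) * ((q p).2 - (q p).1) -
        ((q p).1 + ((i + 1 : ℕ) / m : ℝ) * ((q p).2 - (q p).1)) = -(((q p).2 - (q p).1) / m) := by
      push_cast; ring
    rw [h1, abs_neg, abs_div, abs_of_pos hm0, div_le_iff₀ hm0]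
    have h2 := abs_le.1 (hq p hp)
    have h3 := abs_le.1 hcπ
    refine le_trans (abs_le.2 ⟨?_, ?_⟩) hr <;> linarith
  · intro p hp p' hp' i hi
    rw [← hq1 p hp, ← hq1 p' hp', ← hq2 p hp, ← hq2 p' hp']
    rcases Nat.eq_zero_or_pos i with rfl | hi0
    · simp
    rcases hi.eq_or_lt with rfl | hi
    · simp [hm0.ne']
    have h1 := abs_le.1 (hq p hp)
    have h2 := abs_le.1 (hq p' hp')
    set a := (q p).1
    set b := (q p).2
    set a' := (q p').1
    set b' := (q p').2
    set l : ℝ := i / m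
    have hl0 : 1 / m ≤ l := by
      simp only [l]; gcongr; exact_mod_cast hi0
    have hl1 : l ≤ 1 - 1 / m := by
      have : (i : ℝ) + 1 ≤ m := by exact_mod_cast hi
      rw [le_sub_iff_add_le, ← add_div, div_le_one hm0]; exact this
    have hD : |(b - b') / 2 - (a - a') / 2| ≤ M := abs_le.2 ⟨by linarith, by linarith⟩
    have hlM : (1 - 1 / m) * M ≤ π / 2 - 1 / m := by
      simp only [M]
      rw [← hη] at hη1 ⊢
      nlinarith
    simp only [dist_ofAngle]
    have := abs_sin_le_abs_sin_add_abs_sin (δ := 1 / (3 * m)) (η := 1 / m)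
      (u := (a - a') / 2) (v := (b - b') / 2)
      (w := (a + l * (b - a) - (a' + l * (b' - a'))) / 2) hδ hη.le hη1 ?_ ?_ ?_ hD
    · linarith
    · rw [← segment_eq_uIcc]
      exact ⟨1 - l, l, by linarith [one_div_pos.2 hm0], by linarith [one_div_pos.2 hm0], by ring,
        by simp only [smul_eq_mul]; ring⟩
    · rw [show (a + l * (b - a) - (a' + l * (b' - a'))) / 2 - (a - a') / 2
        = l * ((b - b') / 2 - (a - a') / 2) by ring, abs_mul,
        abs_of_nonneg (by linarith [one_div_pos.2 hm0])]
      exact (mul_le_mul hl1 hD (abs_nonneg _) (by linarith)).trans hlM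
    · rw [show (b - b') / 2 - (a + l * (b - a) - (a' + l * (b' - a'))) / 2
        = (1 - l) * ((b - b') / 2 - (a - a') / 2) by ring, abs_mul,
        abs_of_nonneg (by linarith [one_div_pos.2 hm0])]
      exact (mul_le_mul (by linarith) hD (abs_nonneg _) (by linarith)).trans hlM

lemma exists_open_cover {r : ℝ} (hr : 0 < r) :
    ∃ U₁ U₂ : Set (↥Circle2 × ↥Circle2), IsOpen U₁ ∧ IsOpen U₂ ∧ U₁ ∪ U₂ = Set.univ ∧
      HasMotionPlan r U₁ ∧ HasMotionPlan r U₂ := by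
  obtain ⟨n, hn⟩ := exists_nat_ge (7 / r)
  have hm : 7 ≤ r * (n + 2 : ℕ) := by
    rw [div_le_iff₀ hr] at hn
    push_cast
    linarith
  refine ⟨_, _, ?_, ?_, ?_,
    hasMotionPlan_band (c := 0) (Nat.le_add_left 2 n) hm sin_zero (by simp [pi_nonneg]),
    hasMotionPlan_band (c := π) (Nat.le_add_left 2 n) hm sin_pi (abs_of_pos pi_pos).le⟩
  · exact isOpen_lt continuous_const (continuous_const.mul continuous_dot)
  · exact isOpen_lt continuous_const (continuous_const.mul continuous_dot)
  · have h : cos (π / 2 + 1 / (3 * (n + 2 : ℕ))) < 0 := by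
      rw [add_comm, cos_add_pi_div_two, neg_lt_zero]
      apply sin_pos_of_pos_of_lt_pi (by positivity)
      have : 1 / (3 * ((n + 2 : ℕ) : ℝ)) ≤ 1 := by
        rw [div_le_one (by positivity)]
        push_cast
        linarith [(Nat.cast_nonneg n : (0 : ℝ) ≤ n)]
      linarith [pi_gt_three]
    refine Set.eq_univ_of_forall fun p => ?_
    rw [Set.mem_union, Set.mem_ofPred_eq, Set.mem_ofPred_eq, cos_zero, cos_pi]
    rcases le_total 0 (dot p.1 p.2) with h0 | h0
    · left; linarith
    · right; linarith

/-- Continuous maps to the circle that stay at distance less than `2` lift to the line together. -/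
lemma exists_continuous_lift_of_dist_lt_two {Y : Type*} [TopologicalSpace Y] {f g : Y → ↥Circle2}
    (hf : Continuous f) (hg : Continuous g) (hfg : ∀ y, dist (f y) (g y) < 2)
    (h : ∃ φ : Y → ℝ, Continuous φ ∧ ∀ y, ofAngle (φ y) = f y) :
    ∃ ψ : Y → ℝ, Continuous ψ ∧ ∀ y, ofAngle (ψ y) = g y := by
  obtain ⟨φ, hφ, hφf⟩ := h
  let z : Y → ℂ := fun y => ⟨dot (f y) (g y), (f y).1 0 * (g y).1 1 - (f y).1 1 * (g y).1 0⟩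
  have hz : Continuous z := by
    have h1 : Continuous fun y => dot (f y) (g y) := continuous_dot.comp (hf.prodMk hg)
    have h2 : Continuous fun y => (f y).1 0 * (g y).1 1 - (f y).1 1 * (g y).1 0 := by fun_prop
    exact Complex.equivRealProdCLM.symm.continuous.comp (h1.prodMk h2)
  have hrep : ∀ y, ∃ t, z y = ⟨cos t, sin t⟩ ∧ ofAngle (φ y + t) = g y := by
    intro y
    obtain ⟨b, hb⟩ := exists_ofAngle (g y)
    refine ⟨b - φ y, ?_, by rw [add_sub_cancel, hb]⟩
    simp only [z, ← hφf y, ← hb, dot_ofAngle]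
    congr 1
    simp [sin_sub]; ring
  have hnorm : ∀ y, ‖z y‖ = 1 := by
    intro y
    obtain ⟨t, ht, -⟩ := hrep y
    rw [ht, Complex.norm_def, Complex.normSq_mk, ← sq, ← sq, cos_sq_add_sin_sq, sqrt_one]
  have hz0 : ∀ y, z y ≠ 0 := fun y h => by simpa [h] using hnorm y
  have hslit : ∀ y, z y ∈ Complex.slitPlane := by
    intro y
    rw [Complex.mem_slitPlane_iff_not_le_zero]
    intro hle
    obtain ⟨hre, him⟩ := Complex.le_def.1 hle
    obtain ⟨t, ht, htg⟩ := hrep y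
    rw [ht] at hre him
    simp only [Complex.zero_re, Complex.zero_im] at hre him
    have h1 := hfg y
    rw [← hφf y, ← htg, dist_ofAngle] at h1
    have h2 : |sin ((φ y - (φ y + t)) / 2)| < 1 := by linarith
    rw [show (φ y - (φ y + t)) / 2 = -(t / 2) by ring, sin_neg, abs_neg, ← sq_lt_one_iff_abs_lt_one,
      sin_sq_eq_half_sub] at h2
    rw [show 2 * (t / 2) = t by ring] at h2
    have h3 := cos_sq_add_sin_sq t
    rw [him] at h3
    nlinarith
  refine ⟨fun y => φ y + Complex.arg (z y), hφ.add
    (continuous_iff_continuousAt.2 fun y =>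
      (Complex.continuousAt_arg (hslit y)).comp hz.continuousAt), fun y => ?_⟩
  obtain ⟨t, ht, htg⟩ := hrep y
  rw [← htg]
  have hc : cos (Complex.arg (z y)) = cos t := by rw [Complex.cos_arg (hz0 y), hnorm, ht, div_one]
  have hs : sin (Complex.arg (z y)) = sin t := by rw [Complex.sin_arg, hnorm, ht, div_one]
  exact ext_coord (by simp [cos_add, hc, hs]) (by simp [sin_add, hc, hs])

lemma continuous_ofAngle : Continuous ofAngle := by
  refine (LipschitzWith.of_dist_le_mul (K := 1) fun a b => ?_).continuous
  simpa [Real.dist_eq] using dist_ofAngle_le a b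

/-- The identity of the circle does not lift to the line. -/
lemma not_exists_lift_id :
    ¬ ∃ φ : ↥Circle2 → ℝ, Continuous φ ∧ ∀ y, ofAngle (φ y) = y := by
  rintro ⟨φ, hφ, h⟩
  let d : ℝ → ℝ := fun t => φ (ofAngle (t + π)) - φ (ofAngle t)
  have hd : Continuous d := by
    have := continuous_ofAngle
    fun_prop
  have hper : d π = -d 0 := by
    have : ofAngle (π + π) = ofAngle 0 := by
      simpa [two_mul] using ofAngle_add_int_mul 0 1
    simp only [d, this, zero_add]
    ring
  have hmem : (0 : ℝ) ∈ Set.uIcc (d 0) (d π) := by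
    rw [hper, Set.mem_uIcc]
    rcases le_total 0 (d 0) with h0 | h0
    · right; constructor <;> linarith
    · left; constructor <;> linarith
  obtain ⟨t, -, ht⟩ := intermediate_value_uIcc hd.continuousOn hmem
  have heq : ofAngle (t + π) = ofAngle t := by
    rw [← h (ofAngle (t + π)), ← h (ofAngle t), sub_eq_zero.1 ht]
  have h2 : dist (ofAngle (t + π)) (ofAngle t) = 2 := by
    rw [dist_ofAngle]; simp
  rw [heq, dist_self] at h2
  norm_num at h2

lemma not_hasMotionPlan_univ {r : ℝ} (hr : r < 2) :
    ¬ HasMotionPlan r (Set.univ : Set (↥Circle2 × ↥Circle2)) := by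
  rintro ⟨m, s, hs, hLip⟩
  let x₀ : ↥Circle2 := ofAngle 0
  have hcont : ∀ i ≤ m, Continuous fun y => s (x₀, y) i := fun i hi => by
    refine (LipschitzWith.of_dist_le_mul (K := 1) fun y y' => ?_).continuous
    simpa using hLip (x₀, y) trivial (x₀, y') trivial i hi
  have hlift : ∀ i ≤ m, ∃ φ : ↥Circle2 → ℝ, Continuous φ ∧ ∀ y, ofAngle (φ y) = s (x₀, y) i := by
    intro i
    induction i with
    | zero => exact fun _ => ⟨fun _ => 0, continuous_const, fun y => (hs (x₀, y) trivial).1.symm⟩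
    | succ i ih =>
      intro hi
      exact exists_continuous_lift_of_dist_lt_two (hcont i (by omega)) (hcont (i + 1) hi)
        (fun y => ((hs (x₀, y) trivial).2.2 i hi).trans_lt hr) (ih (by omega))
  obtain ⟨φ, hφ, h⟩ := hlift m le_rfl
  exact not_exists_lift_id ⟨φ, hφ, fun y => (h y).trans (hs (x₀, y) trivial).2.1⟩

end Circle2

/-- For `0 < r < 2`, `TC_r(S¹) = 2`: two open subsets of `S¹ × S¹` with `r`-motion
plannings cover `S¹ × S¹`, while no `r`-motion planning exists on all of `S¹ × S¹`. -/
theorem dTC_circle (r : ℝ) (hr0 : 0 < r) (hr2 : r < 2) :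
    (∃ U₁ U₂ : Set (↥Circle2 × ↥Circle2), IsOpen U₁ ∧ IsOpen U₂ ∧ U₁ ∪ U₂ = Set.univ ∧
      HasMotionPlan r U₁ ∧ HasMotionPlan r U₂) ∧
    ¬ HasMotionPlan r (Set.univ : Set (↥Circle2 × ↥Circle2)) ∧
    dTC r ↥Circle2 = 2 := by
  have hcover := Circle2.exists_open_cover hr0
  have hnot := Circle2.not_hasMotionPlan_univ hr2
  refine ⟨hcover, hnot, le_antisymm (sInf_le ?_) (le_sInf ?_)⟩
  · obtain ⟨U₁, U₂, h₁, h₂, hU, hp₁, hp₂⟩ := hcover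
    refine ⟨2, rfl, ![U₁, U₂], ?_, ?_, ?_⟩
    · simp [Fin.forall_fin_two, h₁, h₂]
    · rw [← hU]; ext p; simp [Fin.exists_fin_two]
    · simp [Fin.forall_fin_two, hp₁, hp₂]
  · rintro _ ⟨l, rfl, U, -, hU, hp⟩
    by_contra! hl
    have hl2 : l < 2 := by exact_mod_cast hl
    interval_cases l
    · have : (Circle2.ofAngle 0, Circle2.ofAngle 0) ∈ ⋃ i, U i := hU ▸ Set.mem_univ _
      simp at this
    · have h0 : U 0 = Set.univ := by rw [← hU]; ext p; simp
      exact hnot (h0 ▸ hp 0)
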